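/- Impossibility with risk-averse miners: let U : [0,1] → ℝ be strictly concave, strictly increasing, with U(0) = 0 (hence U(1) > 0). Then there is no nonzero allocation rule that is symmetric, weakly budget-balanced, sybil-proof, and weakly collusion-proof against U under proportional sharing. -/

import Mathlib

/-- An *allocation rule* maps every configuration (a finite tuple of positive
integer hash rates) of every length to a tuple of nonnegative real
(expected) rewards of the same length. -/
structure AllocRule where
  alloc : ∀ {n : ℕ}, (Fin n → ℕ+) → Fin n → ℝ
  nonneg : ∀ {n : ℕ} (h : Fin n → ℕ+) (i : Fin n), 0 ≤ alloc h i

/-- A1: symmetry: `x (π h) = π (x h)` for every permutation `π`. -/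
def SymmetricRule (x : AllocRule) : Prop :=
  ∀ {n : ℕ}, 0 < n → ∀ (h : Fin n → ℕ+) (π : Equiv.Perm (Fin n)) (i : Fin n),
    x.alloc (h ∘ π) i = x.alloc h (π i)

/-- A2a: strong budget balance. -/
def StronglyBudgetBalanced (x : AllocRule) : Prop :=
  ∀ {n : ℕ}, 0 < n → ∀ h : Fin n → ℕ+, ∑ i, x.alloc h i = 1

/-- A2b: weak budget balance. -/
def WeaklyBudgetBalanced (x : AllocRule) : Prop :=
  ∀ {n : ℕ}, 0 < n → ∀ h : Fin n → ℕ+, ∑ i, x.alloc h i ≤ 1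

/-- `h'` (whose set of new-entry positions is `S`) is obtained from `h` by
replacing the single entry at index `i` with a finite tuple of positive
integers summing to at most `h i`, all other entries unchanged. -/
def IsSybilSplit {n m : ℕ} (h : Fin n → ℕ+) (i : Fin n)
    (h' : Fin m → ℕ+) (S : Finset (Fin m)) : Prop :=
  S.Nonempty ∧
  ∃ e : {j : Fin n // j ≠ i} ↪ Fin m,
    (∀ j, h' (e j) = h j.1) ∧
    (∀ k : Fin m, k ∈ S ↔ k ∉ Set.range e) ∧
    (∑ k ∈ S, (h' k : ℕ)) ≤ (h i : ℕ)

/-- A3: sybil-proofness. -/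
def SybilProof (x : AllocRule) : Prop :=
  ∀ {n m : ℕ}, 0 < n →
    ∀ (h : Fin n → ℕ+) (i : Fin n) (h' : Fin m → ℕ+) (S : Finset (Fin m)),
      IsSybilSplit h i h' S → ∑ j ∈ S, x.alloc h' j ≤ x.alloc h i

/-- `h'` (with merged-miner position `istar`) is obtained from `h` by
replacing the (nonempty) set `T` of miners with a single new miner whose hash
rate is at most the total hash rate of `T`, all other entries unchanged. -/
def IsMerge {n m : ℕ} (h : Fin n → ℕ+) (T : Finset (Fin n))
    (h' : Fin m → ℕ+) (istar : Fin m) : Prop :=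
  T.Nonempty ∧
  ∃ e : {j : Fin n // j ∉ T} ↪ Fin m,
    (∀ j, h' (e j) = h j.1) ∧
    (∀ k : Fin m, k = istar ↔ k ∉ Set.range e) ∧
    (h' istar : ℕ) ≤ ∑ j ∈ T, (h j : ℕ)

/-- A4a: collusion-proofness under arbitrary reward sharing. -/
def CollusionProofArbitrary (x : AllocRule) : Prop :=
  ∀ {n m : ℕ}, 0 < n →
    ∀ (h : Fin n → ℕ+) (T : Finset (Fin n)) (h' : Fin m → ℕ+) (istar : Fin m),
      IsMerge h T h' istar → x.alloc h' istar ≤ ∑ j ∈ T, x.alloc h j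

/-- A4b: strong collusion-proofness under proportional sharing. -/
def StronglyCollusionProof (x : AllocRule) : Prop :=
  ∀ {n m : ℕ}, 0 < n →
    ∀ (h : Fin n → ℕ+) (T : Finset (Fin n)) (h' : Fin m → ℕ+) (istar : Fin m),
      IsMerge h T h' istar →
      (∃ i ∈ T, x.alloc h i <
        x.alloc h' istar * (((h i : ℕ) : ℝ) / ∑ j ∈ T, ((h j : ℕ) : ℝ))) →
      ∃ l ∈ T, x.alloc h' istar * (((h l : ℕ) : ℝ) / ∑ j ∈ T, ((h j : ℕ) : ℝ))
        < x.alloc h l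

/-- A4c: weak collusion-proofness under proportional sharing. -/
def WeaklyCollusionProof (x : AllocRule) : Prop :=
  ∀ {n m : ℕ}, 0 < n →
    ∀ (h : Fin n → ℕ+) (T : Finset (Fin n)) (h' : Fin m → ℕ+) (istar : Fin m),
      IsMerge h T h' istar →
      ∃ i ∈ T, x.alloc h' istar * (((h i : ℕ) : ℝ) / ∑ j ∈ T, ((h j : ℕ) : ℝ))
        ≤ x.alloc h i

/-- Bitcoin's proportional allocation rule. -/
noncomputable def propRule : AllocRule where
  alloc := fun {n} h i => ((h i : ℕ) : ℝ) / ∑ j, ((h j : ℕ) : ℝ)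
  nonneg := fun h i => div_nonneg (Nat.cast_nonneg _)
    (Finset.sum_nonneg fun j _ => Nat.cast_nonneg _)

/-- Weak collusion-proofness against a utility function `U` under proportional
sharing (A4c with general utility functions). -/
def WeaklyCollusionProofAgainst (U : ℝ → ℝ) (x : AllocRule) : Prop :=
  ∀ {n m : ℕ}, 0 < n →
    ∀ (h : Fin n → ℕ+) (T : Finset (Fin n)) (h' : Fin m → ℕ+) (istar : Fin m),
      IsMerge h T h' istar →
      ∃ i ∈ T, x.alloc h' istar *
          U (((h i : ℕ) : ℝ) / ∑ j ∈ T, ((h j : ℕ) : ℝ))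
        ≤ U 1 * x.alloc h i

/-- A lone miner may split into any configuration of no larger total hash rate. -/
theorem SybilProof.sum_alloc_le_alloc_single {x : AllocRule} (hx : SybilProof x) {m : ℕ}
    (hm : 0 < m) (h : Fin m → ℕ+) (N : ℕ+) (hN : ∑ k, (h k : ℕ) ≤ N) :
    ∑ j, x.alloc h j ≤ x.alloc (fun _ : Fin 1 => N) 0 := by
  have : IsEmpty {j : Fin 1 // j ≠ 0} := ⟨fun j => j.2 (Subsingleton.elim _ _)⟩
  exact hx one_pos (fun _ => N) 0 h Finset.univ
    ⟨⟨⟨0, hm⟩, Finset.mem_univ _⟩, Function.Embedding.ofIsEmpty,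
      fun j => isEmptyElim j, fun k => by simp, hN⟩

/-- All miners together may merge into a lone miner of no larger hash rate. -/
theorem WeaklyCollusionProofAgainst.exists_alloc_single_mul_le {U : ℝ → ℝ} {x : AllocRule}
    (hx : WeaklyCollusionProofAgainst U x) {n : ℕ} (hn : 0 < n) (h : Fin n → ℕ+) (N : ℕ+)
    (hN : (N : ℕ) ≤ ∑ k, (h k : ℕ)) :
    ∃ i, x.alloc (fun _ : Fin 1 => N) 0 * U (((h i : ℕ) : ℝ) / ∑ j, ((h j : ℕ) : ℝ))
      ≤ U 1 * x.alloc h i := by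
  have : IsEmpty {j : Fin n // j ∉ Finset.univ} := ⟨fun j => j.2 (Finset.mem_univ _)⟩
  obtain ⟨i, -, hi⟩ := hx hn h Finset.univ (fun _ : Fin 1 => N) 0
    ⟨⟨⟨0, hn⟩, Finset.mem_univ _⟩, Function.Embedding.ofIsEmpty,
      fun j => isEmptyElim j, fun k => by simp [Subsingleton.elim k 0], hN⟩
  exact ⟨i, hi⟩

/-- A symmetric rule gives equal rewards in a constant configuration. -/
theorem SymmetricRule.alloc_const_eq {x : AllocRule} (hx : SymmetricRule x) {n : ℕ} (c : ℕ+)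
    (i j : Fin n) : x.alloc (fun _ => c) i = x.alloc (fun _ => c) j := by
  have h := hx i.pos (fun _ => c) (Equiv.swap i j) i
  rwa [Equiv.swap_apply_left] at h

/-- A strictly concave function on `[0,1]` vanishing at `0` lies strictly above its chord. -/
theorem StrictConcaveOn.mul_lt_of_zero {U : ℝ → ℝ}
    (hU : StrictConcaveOn ℝ (Set.Icc (0 : ℝ) 1) U) (hU0 : U 0 = 0) {t : ℝ}
    (ht0 : 0 < t) (ht1 : t < 1) : t * U 1 < U t := by
  have h := hU.2 (Set.right_mem_Icc.2 zero_le_one) (Set.left_mem_Icc.2 zero_le_one)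
    one_ne_zero ht0 (sub_pos.2 ht1) (add_sub_cancel t 1)
  simpa [hU0] using h

/-- Theorem 3, impossibility with risk-averse miners: if `U`
is strictly concave and strictly increasing on `[0,1]` with `U 0 = 0`, then no
nonzero allocation rule is symmetric, weakly budget-balanced, sybil-proof, and
weakly collusion-proof against `U` under proportional sharing. -/
theorem impossibility_risk_averse (U : ℝ → ℝ)
    (hConc : StrictConcaveOn ℝ (Set.Icc (0 : ℝ) 1) U)
    (hMono : StrictMonoOn U (Set.Icc (0 : ℝ) 1))
    (hU0 : U 0 = 0) :
    ¬ ∃ x : AllocRule,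
        (∃ (n : ℕ), 0 < n ∧ ∃ (h : Fin n → ℕ+) (i : Fin n), 0 < x.alloc h i) ∧
        SymmetricRule x ∧ WeaklyBudgetBalanced x ∧ SybilProof x ∧
        WeaklyCollusionProofAgainst U x := by
  rintro ⟨x, ⟨n, hn, h, i, hi⟩, hSym, -, hSyb, hCol⟩
  obtain ⟨N, hN⟩ : ∃ N : ℕ+, (N : ℕ) = ∑ k, (h k : ℕ) + 1 := ⟨⟨_, Nat.succ_pos _⟩, rfl⟩
  have hN1 : 1 < (N : ℕ) := by
    have : (h i : ℕ) ≤ ∑ k, (h k : ℕ) := Finset.single_le_sum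
      (f := fun k => (h k : ℕ)) (fun _ _ => Nat.zero_le _) (Finset.mem_univ i)
    have := (h i).pos
    omega
  have hpos : 0 < x.alloc (fun _ : Fin 1 => N) 0 :=
    hi.trans_le ((Finset.single_le_sum (fun k _ => x.nonneg h k) (Finset.mem_univ i)).trans
      (SybilProof.sum_alloc_le_alloc_single hSyb hn h N (by omega)))
  obtain ⟨k, hk⟩ := WeaklyCollusionProofAgainst.exists_alloc_single_mul_le hCol N.pos (fun _ : Fin N => 1) N (by simp)
  have hsum := SybilProof.sum_alloc_le_alloc_single hSyb N.pos (fun _ : Fin N => 1) N (by simp)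
  rw [Finset.sum_congr rfl fun j _ => SymmetricRule.alloc_const_eq hSym 1 j k] at hsum
  simp only [Finset.sum_const, Finset.card_univ, Fintype.card_fin, nsmul_eq_mul, PNat.one_coe,
    Nat.cast_one, mul_one] at hk hsum
  have hNR : (1 : ℝ) < ((N : ℕ) : ℝ) := by exact_mod_cast hN1
  have hN0 : (0 : ℝ) < ((N : ℕ) : ℝ) := one_pos.trans hNR
  have hchord := hConc.mul_lt_of_zero hU0 (one_div_pos.2 hN0) ((div_lt_one hN0).2 hNR)
  have hU1 : 0 < U 1 := hU0 ▸ hMono (Set.left_mem_Icc.2 zero_le_one)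
    (Set.right_mem_Icc.2 zero_le_one) one_pos
  have hlt : U 1 < (N : ℕ) * U (1 / (N : ℕ)) := by
    have := mul_lt_mul_of_pos_left hchord hN0
    rwa [← mul_assoc, mul_one_div_cancel hN0.ne', one_mul] at this
  have h1 := mul_lt_mul_of_pos_left hlt hpos
  have h2 := mul_le_mul_of_nonneg_left hk hN0.le
  have h3 := mul_le_mul_of_nonneg_left hsum hU1.le
  linarith
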